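/- Let k ≥ 1 and m ≥ 0. The elements ζ̄_{m+1}, ζ̄_{m+2}, …, ζ̄_{m+k} form a regular sequence in A⟨k⟩ = F₂[ξ₁, …, ξ_k] (that is, each ζ̄_{m+i} is a nonzerodivisor on A⟨k⟩/(ζ̄_{m+1}, …, ζ̄_{m+i−1}), and the ideal they generate is proper). Moreover, A⟨k⟩ is a free module over the polynomial ring F₂[y₁, …, y_k] acting via y_i ↦ ζ̄_{m+i}. -/

import Mathlib

open MvPolynomial

/-- The dual Steenrod algebra `A = F₂[ξ₁, ξ₂, …]`; the variable `X i` represents `ξ_{i+1}`. -/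
noncomputable abbrev DualSteenrod : Type := MvPolynomial ℕ (ZMod 2)

/-- The conjugate classes, via Milnor's recursion
`ζ_n = ∑_{i=1}^{n} ξ_i^{2^{n−i}} ζ_{n−i}` (with `ζ_0 = 1`). -/
noncomputable def zeta : ℕ → DualSteenrod
  | 0 => 1
  | (n+1) => ∑ i ∈ Finset.range (n+1), (X i) ^ (2^(n-i)) * zeta (n-i)
  decreasing_by omega

/-- The projection `A → A⟨k⟩ = F₂[ξ₁, …, ξ_k]`, killing `ξ_i` for `i > k`.
In `MvPolynomial (Fin k) (ZMod 2)`, the variable `X i` represents `ξ_{i+1}`. -/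
noncomputable def proj (k : ℕ) :
    DualSteenrod →ₐ[ZMod 2] MvPolynomial (Fin k) (ZMod 2) :=
  aeval (fun i => if h : i < k then X (⟨i, h⟩ : Fin k) else 0)

/-- `ζ̄_n`, the image of `ζ_n` in `A⟨k⟩`. -/
noncomputable def zetaBar (k n : ℕ) : MvPolynomial (Fin k) (ZMod 2) :=
  proj k (zeta n)

open RingTheory.Sequence
open scoped Pointwise

section Graded

variable {F R : Type*} [Field F] [CommRing R] [Algebra F R] (𝒜 : ℕ → Submodule F R)
  [GradedAlgebra 𝒜]

/-- A graded form of Nakayama's lemma: if `r ∈ K` implies `r ∈ a K + J` for homogeneous ideals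
`K`, `J` and a homogeneous element `a` of positive degree, then `K ≤ J`. -/
theorem Ideal.IsHomogeneous.le_of_forall_exists_sub_mul_mem {K J : Ideal R}
    (hK : K.IsHomogeneous 𝒜) (hJ : J.IsHomogeneous 𝒜) {a : R} {d : ℕ} (hd : 0 < d)
    (ha : a ∈ 𝒜 d) (h : ∀ r ∈ K, ∃ x ∈ K, r - a * x ∈ J) : K ≤ J := by
  have key : ∀ n, ∀ r ∈ K, r ∈ 𝒜 n → r ∈ J := by
    intro n
    induction n using Nat.strong_induction_on with
    | _ n ih =>
      intro r hr hrn
      obtain ⟨x, hx, hrx⟩ := h r hr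
      have h1 := hJ n hrx
      rw [DirectSum.decompose_sub, DirectSum.sub_apply, AddSubgroupClass.coe_sub,
        DirectSum.decompose_of_mem_same 𝒜 hrn] at h1
      by_cases hdn : d ≤ n
      · rw [DirectSum.coe_decompose_mul_of_left_mem_of_le 𝒜 ha hdn] at h1
        have h2 := ih (n - d) (by omega) _ (hK (n - d) hx) (SetLike.coe_mem _)
        simpa using J.add_mem h1 (J.mul_mem_left a h2)
      · rwa [DirectSum.coe_decompose_mul_of_left_mem_of_not_le 𝒜 ha hdn, sub_zero] at h1
  intro r hr
  exact hJ.mem_iff.2 fun n => key n _ (hK n hr) (SetLike.coe_mem _)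

/-- A weakly regular sequence of homogeneous elements of positive degree remains weakly regular
after any permutation. -/
theorem RingTheory.Sequence.IsWeaklyRegular.perm_of_homogeneous {rs rs' : List R}
    (h : IsWeaklyRegular R rs) (hp : rs.Perm rs')
    (hrs : ∀ r ∈ rs, ∃ d, 0 < d ∧ r ∈ 𝒜 d) : IsWeaklyRegular R rs' := by
  refine h.prototype_perm hp fun a b ts hsub => ?_
  obtain ⟨d, hd, ha⟩ := hrs a (hsub.subset (by simp))
  obtain ⟨e, -, hb⟩ := hrs b (hsub.subset (by simp))
  generalize hJdef : (Ideal.ofList ts • ⊤ : Ideal R) = J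
  intro K hKa
  have hJ : J.IsHomogeneous 𝒜 := by
    rw [← hJdef, smul_eq_mul, Ideal.mul_top]
    refine Ideal.homogeneous_span _ _ fun t ht => ?_
    obtain ⟨c, -, hc⟩ := hrs t (hsub.subset (by simp_all))
    exact ⟨c, hc⟩
  have memK (r : R) : Submodule.Quotient.mk (p := J) r ∈ K ↔ b * r ∈ J := by
    rw [Submodule.mem_torsionBy_iff, ← Submodule.Quotient.mk_smul,
      Submodule.Quotient.mk_eq_zero, smul_eq_mul]
  let K' : Ideal R := K.comap J.mkQ
  have memK' (r : R) : r ∈ K' ↔ b * r ∈ J := memK r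
  have hK' : K'.IsHomogeneous 𝒜 := by
    intro n r hr
    rw [memK'] at hr ⊢
    have := hJ (e + n) hr
    rwa [DirectSum.coe_decompose_mul_of_left_mem_of_le 𝒜 hb (by omega),
      Nat.add_sub_cancel_left] at this
  have hle : K' ≤ J := by
    refine hK'.le_of_forall_exists_sub_mul_mem 𝒜 hJ hd ha fun r hr => ?_
    have h1 : Submodule.Quotient.mk (p := J) r ∈ a • K := hKa ▸ hr
    obtain ⟨y, hy, hyr⟩ := Submodule.mem_smul_pointwise_iff_exists _ _ _ |>.1 h1
    obtain ⟨x, rfl⟩ := Submodule.Quotient.mk_surjective _ y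
    refine ⟨x, hy, ?_⟩
    rw [← smul_eq_mul, ← Submodule.Quotient.mk_eq_zero, Submodule.Quotient.mk_sub,
      Submodule.Quotient.mk_smul, hyr, sub_self]
  rw [eq_bot_iff]
  intro y hy
  obtain ⟨x, rfl⟩ := Submodule.Quotient.mk_surjective _ y
  exact (Submodule.Quotient.mk_eq_zero _).2 (hle hy)

end Graded

theorem MvPolynomial.exists_eq_rename_succ_add_X_zero_mul {F : Type*} [CommSemiring F] {k : ℕ}
    (p : MvPolynomial (Fin (k + 1)) F) :
    ∃ (p₀ : MvPolynomial (Fin k) F) (q : MvPolynomial (Fin (k + 1)) F),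
      p = rename Fin.succ p₀ + X 0 * q := by
  induction p using MvPolynomial.induction_on with
  | C a => exact ⟨C a, 0, by simp⟩
  | add p p' hp hp' =>
    obtain ⟨p₀, q, rfl⟩ := hp
    obtain ⟨p₀', q', rfl⟩ := hp'
    exact ⟨p₀ + p₀', q + q', by rw [map_add]; ring⟩
  | mul_X p i hp =>
    obtain ⟨p₀, q, rfl⟩ := hp
    cases i using Fin.cases with
    | zero => exact ⟨0, rename Fin.succ p₀ + X 0 * q, by rw [map_zero]; ring⟩
    | succ j => exact ⟨p₀ * X j, q * X j.succ, by rw [map_mul, rename_X]; ring⟩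

theorem MvPolynomial.eq_zero_of_forall_X_pow_dvd {F σ : Type*} [Field F]
    {p : MvPolynomial σ F} (i : σ) (h : ∀ n : ℕ, X i ^ n ∣ p) : p = 0 := by
  by_contra hp
  obtain ⟨q, hq⟩ := h (p.totalDegree + 1)
  have hq0 : q ≠ 0 := by rintro rfl; exact hp (by simpa using hq)
  have := congrArg totalDegree hq
  rw [totalDegree_mul_of_isDomain (pow_ne_zero _ (X_ne_zero i)) hq0, totalDegree_X_pow] at this
  omega

/-- If `f` is weakly regular on `M`, a family in `M` which is linearly independent over `F` modulo
`(f) M` is linearly independent over the polynomial ring acting through `f`. -/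
theorem RingTheory.Sequence.IsWeaklyRegular.eq_zero_of_sum_aeval_smul_eq_zero {F R : Type*}
    [Field F] [CommRing R] [Algebra F R] {k : ℕ} {f : Fin k → R} {M : Type*} [AddCommGroup M]
    [Module R M] {ι : Type*} {b : ι → M} (hf : IsWeaklyRegular M (List.ofFn f))
    (hb : ∀ (s : Finset ι) (c : ι → F),
      ∑ i ∈ s, algebraMap F R (c i) • b i ∈ Ideal.ofList (List.ofFn f) • (⊤ : Submodule R M) →
        ∀ i ∈ s, c i = 0)
    (s : Finset ι) (p : ι → MvPolynomial (Fin k) F) (hp : ∑ i ∈ s, aeval f (p i) • b i = 0) :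
    ∀ i ∈ s, p i = 0 := by
  induction k generalizing M s with
  | zero =>
    have hC (i : ι) : p i = C ((p i).coeff 0) := eq_C_of_isEmpty _
    have := hb s (fun i => (p i).coeff 0) (by
      convert! Submodule.zero_mem _
      rw [← hp]
      refine Finset.sum_congr rfl fun i _ => ?_
      conv_rhs => rw [hC i, aeval_C])
    intro i hi
    rw [hC i, this i hi, map_zero]
  | succ k ih =>
    rw [List.ofFn_succ] at hf hb
    obtain ⟨h0, hf'⟩ := (isWeaklyRegular_cons_iff _ _ _).1 hf
    have hb' : ∀ (s : Finset ι) (c : ι → F),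
        ∑ i ∈ s, algebraMap F R (c i) • (Submodule.Quotient.mk (b i) : QuotSMulTop (f 0) M) ∈
          Ideal.ofList (List.ofFn fun i : Fin k => f i.succ) •
            (⊤ : Submodule R (QuotSMulTop (f 0) M)) → ∀ i ∈ s, c i = 0 := by
      intro s c hc
      refine hb s c ?_
      rw [Ideal.ofList_cons_smul, sup_comm]
      have h1 : (⊤ : Submodule R (QuotSMulTop (f 0) M)) =
          Submodule.map (Submodule.mkQ _) ⊤ := by simp
      rw [h1, ← Submodule.map_smul''] at hc
      rw [← Submodule.ker_mkQ (f 0 • (⊤ : Submodule R M)), ← Submodule.comap_map_eq,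
        Submodule.mem_comap]
      simpa using hc
    have key : ∀ n : ℕ, ∀ p : ι → MvPolynomial (Fin (k + 1)) F,
        ∑ i ∈ s, aeval f (p i) • b i = 0 → ∀ i ∈ s, X 0 ^ n ∣ p i := by
      intro n
      induction n with
      | zero => simp
      | succ n ihn =>
        intro p hp
        choose p₀ q hpq using fun i => exists_eq_rename_succ_add_X_zero_mul (p i)
        have haeval (i : ι) :
            aeval f (p i) = aeval (fun j : Fin k => f j.succ) (p₀ i) + f 0 * aeval f (q i) := by
          rw [hpq i, map_add, map_mul, aeval_X, aeval_rename]
          rfl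
        have hp₀ : ∀ i ∈ s, p₀ i = 0 := by
          refine ih hf' hb' s p₀ ?_
          have h2 := congrArg (Submodule.mkQ (f 0 • (⊤ : Submodule R M))) hp
          rw [map_sum, map_zero] at h2
          rw [← h2]
          refine Finset.sum_congr rfl fun i _ => ?_
          have h3 : Submodule.mkQ (f 0 • (⊤ : Submodule R M)) (f 0 • aeval f (q i) • b i) = 0 :=
            (Submodule.Quotient.mk_eq_zero _).2
              (Submodule.smul_mem_pointwise_smul _ _ _ Submodule.mem_top)
          rw [haeval, add_smul, mul_smul, map_add, map_smul, h3, add_zero]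
          rfl
        have hq : ∑ i ∈ s, aeval f (q i) • b i = 0 := by
          refine h0 ?_
          simp only [smul_zero]
          rw [Finset.smul_sum, ← hp]
          refine Finset.sum_congr rfl fun i hi => ?_
          rw [haeval, hp₀ i hi, map_zero, zero_add, mul_smul]
        intro i hi
        rw [hpq i, hp₀ i hi, map_zero, zero_add, pow_succ']
        exact mul_dvd_mul_left _ (ihn q hq i hi)
    exact fun i hi => eq_zero_of_forall_X_pow_dvd 0 fun n => key n p hp i hi

/-- Over a field `F`, a graded `F`-algebra is a free module over the polynomial ring acting through
a weakly regular sequence of homogeneous elements of positive degree. -/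
theorem RingTheory.Sequence.IsWeaklyRegular.free_compHom_aeval {F R : Type*} [Field F]
    [CommRing R] [Algebra F R] (𝒜 : ℕ → Submodule F R) [GradedAlgebra 𝒜] {k : ℕ} {f : Fin k → R}
    (hf : IsWeaklyRegular R (List.ofFn f)) {d : Fin k → ℕ} (hd : ∀ i, 0 < d i)
    (hfd : ∀ i, f i ∈ 𝒜 (d i)) :
    @Module.Free (MvPolynomial (Fin k) F) R _ _
      (Module.compHom _ (aeval f : MvPolynomial (Fin k) F →ₐ[F] R).toRingHom) := by
  let _ : Module (MvPolynomial (Fin k) F) R :=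
    Module.compHom _ (aeval f : MvPolynomial (Fin k) F →ₐ[F] R).toRingHom
  have smul_eq (p : MvPolynomial (Fin k) F) (r : R) : p • r = aeval f p * r := rfl
  have hI : Ideal.ofList (List.ofFn f) = Ideal.span (Set.range f) := by
    rw [Ideal.ofList]
    exact congrArg _ (Set.ext fun r => List.mem_ofFn)
  obtain ⟨κ, a, -, hspan, hli⟩ := exists_linearIndependent' F
    fun x : (Σ n, 𝒜 n) => Ideal.Quotient.mkₐ F (Ideal.span (Set.range f)) x.2
  let b : κ → R := fun j => (a j).2
  have hind : LinearIndependent (MvPolynomial (Fin k) F) b := by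
    rw [linearIndependent_iff']
    intro s p hp
    refine hf.eq_zero_of_sum_aeval_smul_eq_zero (b := b) (fun s c hc => ?_) s p hp
    refine linearIndependent_iff'.1 hli s c ?_
    rw [hI, smul_eq_mul, Ideal.mul_top, ← Ideal.Quotient.eq_zero_iff_mem, ← Ideal.Quotient.mkₐ_eq_mk F,
      map_sum] at hc
    rw [← hc]
    refine Finset.sum_congr rfl fun i _ => ?_
    rw [algebraMap_smul, map_smul]
    rfl
  have hmem : ∀ n, ∀ r ∈ 𝒜 n, r ∈ Submodule.span (MvPolynomial (Fin k) F) (Set.range b) := by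
    intro n
    induction n using Nat.strong_induction_on with
    | _ n ih =>
      intro r hr
      have h1 : Ideal.Quotient.mkₐ F (Ideal.span (Set.range f)) r ∈ Submodule.span F
          (Set.range ((fun x : (Σ n, 𝒜 n) =>
            Ideal.Quotient.mkₐ F (Ideal.span (Set.range f)) (x.2 : R)) ∘ a)) :=
        hspan ▸ Submodule.subset_span ⟨⟨n, r, hr⟩, rfl⟩
      obtain ⟨c, hc⟩ := Finsupp.mem_span_range_iff_exists_finsupp.1 h1
      have h2 : r - c.sum (fun j t => t • b j) ∈ Ideal.span (Set.range f) := by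
        rw [← Ideal.Quotient.eq_zero_iff_mem, ← Ideal.Quotient.mkₐ_eq_mk F, map_sub, ← hc,
          sub_eq_zero, Finsupp.sum, Finsupp.sum, map_sum]
        refine Finset.sum_congr rfl fun i _ => ?_
        rw [map_smul]
        rfl
      obtain ⟨g, hg⟩ := Ideal.mem_span_range_iff_exists_fun.1 h2
      have h3 : r = GradedRing.proj 𝒜 n (c.sum fun j t => t • b j) +
          ∑ i, GradedRing.proj 𝒜 n (f i * g i) := by
        rw [← map_sum, ← map_add, Finset.sum_congr rfl fun i _ => mul_comm (f i) (g i), hg,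
          add_sub_cancel, GradedRing.proj_apply, DirectSum.decompose_of_mem_same 𝒜 hr]
      rw [h3]
      refine Submodule.add_mem _ ?_ (Submodule.sum_mem _ fun i _ => ?_)
      · rw [Finsupp.sum, map_sum]
        refine Submodule.sum_mem _ fun j _ => ?_
        have hbj : c j • b j ∈ 𝒜 (a j).1 := (𝒜 _).smul_mem _ (a j).2.2
        rw [GradedRing.proj_apply]
        by_cases hn : (a j).1 = n
        · rw [← hn, DirectSum.decompose_of_mem_same 𝒜 hbj]
          have : c j • b j = (C (c j) : MvPolynomial (Fin k) F) • b j := by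
            rw [smul_eq, aeval_C, Algebra.smul_def]
          rw [this]
          exact Submodule.smul_mem _ _ (Submodule.subset_span ⟨j, rfl⟩)
        · rw [DirectSum.decompose_of_mem_ne 𝒜 hbj hn]
          exact Submodule.zero_mem _
      · rw [GradedRing.proj_apply]
        by_cases hn : d i ≤ n
        · rw [DirectSum.coe_decompose_mul_of_left_mem_of_le 𝒜 (hfd i) hn]
          have := Submodule.smul_mem _ (X i : MvPolynomial (Fin k) F)
            (ih (n - d i) (by have := hd i; omega) _
              (SetLike.coe_mem (DirectSum.decompose 𝒜 (g i) (n - d i))))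
          rwa [smul_eq, aeval_X] at this
        · rw [DirectSum.coe_decompose_mul_of_left_mem_of_not_le 𝒜 (hfd i) hn]
          exact Submodule.zero_mem _
  have hsp : ⊤ ≤ Submodule.span (MvPolynomial (Fin k) F) (Set.range b) := by
    intro r _
    classical
    rw [← DirectSum.sum_support_decompose 𝒜 r]
    exact Submodule.sum_mem _ fun n _ => hmem n _ (SetLike.coe_mem _)
  exact Module.Free.of_basis (Module.Basis.mk hind hsp)

theorem proj_X (k i : ℕ) :
    proj k (X i) = if h : i < k then X (⟨i, h⟩ : Fin k) else 0 := by
  rw [proj, aeval_X]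

theorem zetaBar_zero (k : ℕ) : zetaBar k 0 = 1 := by
  rw [zetaBar, zeta, map_one]

theorem zetaBar_succ (k n : ℕ) :
    zetaBar k (n + 1) =
      ∑ i ∈ Finset.range (n + 1), proj k (X i) ^ 2 ^ (n - i) * zetaBar k (n - i) := by
  rw [zetaBar, zeta, map_sum]
  simp only [map_mul, map_pow, zetaBar]

/-- The internal degree on `A⟨k⟩`, in which `ξ_i` has degree `2 ^ i - 1`. -/
def xiDegree (k : ℕ) (i : Fin k) : ℕ := 2 ^ (i + 1 : ℕ) - 1

theorem proj_X_isWeightedHomogeneous (k i : ℕ) :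
    (proj k (X i)).IsWeightedHomogeneous (xiDegree k) (2 ^ (i + 1) - 1) := by
  rw [proj_X]
  split_ifs with h
  · exact isWeightedHomogeneous_X _ _ _
  · exact isWeightedHomogeneous_zero _ _ _

theorem zetaBar_isWeightedHomogeneous (k n : ℕ) :
    (zetaBar k n).IsWeightedHomogeneous (xiDegree k) (2 ^ n - 1) := by
  induction n using Nat.strong_induction_on with
  | _ n ih =>
    cases n with
    | zero => rw [zetaBar_zero]; exact isWeightedHomogeneous_one _ _
    | succ n =>
      rw [zetaBar_succ]
      refine IsWeightedHomogeneous.sum _ _ _ fun i hi => ?_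
      have hin : i ≤ n := Nat.lt_succ_iff.1 (Finset.mem_range.1 hi)
      convert! ((proj_X_isWeightedHomogeneous k i).pow (2 ^ (n - i))).mul
        (ih (n - i) (by omega)) using 1
      obtain ⟨j, rfl⟩ := Nat.exists_eq_add_of_le hin
      have h1 : 1 ≤ 2 ^ j := Nat.one_le_two_pow
      have h2 : 1 ≤ 2 ^ (i + 1) := Nat.one_le_two_pow
      rw [Nat.add_sub_cancel_left, smul_eq_mul, Nat.mul_sub, ← pow_add, mul_one,
        show j + (i + 1) = i + j + 1 by ring]
      have h3 : 2 ^ j ≤ 2 ^ (i + j + 1) := Nat.pow_le_pow_right (by norm_num) (by omega)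
      omega

/-- The projection `A⟨k+1⟩ → A⟨k⟩` killing `ξ_{k+1}`. -/
noncomputable def killLast (k : ℕ) :
    MvPolynomial (Fin (k + 1)) (ZMod 2) →ₐ[ZMod 2] MvPolynomial (Fin k) (ZMod 2) :=
  aeval (Fin.lastCases 0 X)

theorem killLast_X_last (k : ℕ) : killLast k (X (Fin.last k)) = 0 := by
  simp [killLast]

theorem killLast_X_castSucc (k : ℕ) (i : Fin k) : killLast k (X i.castSucc) = X i := by
  simp [killLast]

theorem killLast_rename_castSucc (k : ℕ) (p : MvPolynomial (Fin k) (ZMod 2)) :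
    killLast k (rename Fin.castSucc p) = p := by
  rw [killLast, aeval_rename]
  convert aeval_X_left_apply p
  ext1 i
  simp

theorem killLast_zetaBar (k n : ℕ) : killLast k (zetaBar (k + 1) n) = zetaBar k n := by
  have : (killLast k).comp (proj (k + 1)) = proj k := by
    ext1 i
    rw [AlgHom.comp_apply, proj_X, proj_X]
    rcases lt_trichotomy i k with h | rfl | h
    · rw [dif_pos h, dif_pos (by omega)]
      exact killLast_X_castSucc k ⟨i, h⟩
    · rw [dif_pos (by omega), dif_neg (by omega)]
      exact killLast_X_last i
    · rw [dif_neg (by omega), dif_neg (by omega), map_zero]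
  exact DFunLike.congr_fun this (zeta n)

theorem ker_killLast (k : ℕ) :
    RingHom.ker (killLast k) = Ideal.span {X (Fin.last k)} := by
  refine le_antisymm (fun p hp => ?_) ?_
  · have h : (Ideal.Quotient.mkₐ (ZMod 2) (Ideal.span {X (Fin.last k)})).comp
        ((rename Fin.castSucc).comp (killLast k)) = Ideal.Quotient.mkₐ (ZMod 2) _ := by
      ext1 i
      cases i using Fin.lastCases with
      | last =>
        rw [AlgHom.comp_apply, AlgHom.comp_apply, killLast_X_last, map_zero, map_zero, eq_comm,
          Ideal.Quotient.mkₐ_eq_mk, Ideal.Quotient.eq_zero_iff_mem]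
        exact Ideal.subset_span rfl
      | cast i => rw [AlgHom.comp_apply, AlgHom.comp_apply, killLast_X_castSucc, rename_X]
    have := DFunLike.congr_fun h p
    rw [AlgHom.comp_apply, AlgHom.comp_apply, (RingHom.mem_ker).1 hp, map_zero, map_zero,
      eq_comm, Ideal.Quotient.mkₐ_eq_mk, Ideal.Quotient.eq_zero_iff_mem] at this
    exact this
  · rw [Ideal.span_singleton_le_iff_mem]
    exact killLast_X_last k

theorem isWeaklyRegular_X_last_cons {k : ℕ} {rs : List (MvPolynomial (Fin (k + 1)) (ZMod 2))}
    (h : IsWeaklyRegular (MvPolynomial (Fin k) (ZMod 2)) (rs.map (killLast k))) :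
    IsWeaklyRegular (MvPolynomial (Fin (k + 1)) (ZMod 2)) (X (Fin.last k) :: rs) := by
  let _ : Algebra (MvPolynomial (Fin (k + 1)) (ZMod 2)) (MvPolynomial (Fin k) (ZMod 2)) :=
    (killLast k).toRingHom.toAlgebra
  let φ := Algebra.linearMap (MvPolynomial (Fin (k + 1)) (ZMod 2)) (MvPolynomial (Fin k) (ZMod 2))
  have hφ : Function.Surjective φ := fun p => ⟨_, killLast_rename_castSucc k p⟩
  have hker : (X (Fin.last k) : MvPolynomial (Fin (k + 1)) (ZMod 2)) •
      (⊤ : Ideal (MvPolynomial (Fin (k + 1)) (ZMod 2))) = LinearMap.ker φ := by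
    rw [← Submodule.ideal_span_singleton_smul, smul_eq_mul, Ideal.mul_top]
    exact (ker_killLast k).symm
  refine (isWeaklyRegular_cons_iff _ _ _).2 ⟨IsSMulRegular.of_ne_zero (X_ne_zero _), ?_⟩
  exact (((Submodule.quotEquivOfEq _ _ hker).trans
    (φ.quotKerEquivOfSurjective hφ)).isWeaklyRegular_congr rs).2
      ((isWeaklyRegular_map_algebraMap_iff (MvPolynomial (Fin k) (ZMod 2)) _ rs).1 h)

theorem zetaBar_succ_add_sub_mem (k m : ℕ) :
    zetaBar (k + 1) (m + 1 + k) - X (Fin.last k) ^ 2 ^ m * zetaBar (k + 1) m ∈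
      Ideal.ofList ((List.range k).map fun i => zetaBar (k + 1) (m + 1 + i)) := by
  have hX : proj (k + 1) (X k) = X (Fin.last k) := by
    rw [proj_X, dif_pos (by omega)]
    rfl
  rw [show m + 1 + k = (m + k) + 1 by ring, zetaBar_succ,
    ← Finset.add_sum_erase _ _ (Finset.mem_range.2 (show k < m + k + 1 by omega)),
    Nat.add_sub_cancel, hX, add_sub_cancel_left]
  refine Ideal.sum_mem _ fun i hi => ?_
  rw [Finset.mem_erase, Finset.mem_range] at hi
  rcases Nat.lt_or_gt_of_ne hi.1 with h | h
  · refine Ideal.mul_mem_left _ _ (Ideal.subset_span ?_)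
    simp only [Set.mem_ofPred_eq, List.mem_map, List.mem_range]
    exact ⟨k - 1 - i, by omega, by congr 1; omega⟩
  · rw [proj_X, dif_neg (by omega), zero_pow (by positivity), zero_mul]
    exact Ideal.zero_mem _

theorem IsSMulRegular.quotient_of_sub_mem {R : Type*} [CommRing R] {I : Ideal R} {a b : R}
    (h : a - b ∈ I) (hb : IsSMulRegular (R ⧸ (I • ⊤ : Ideal R)) b) :
    IsSMulRegular (R ⧸ (I • ⊤ : Ideal R)) a := by
  intro x y hxy
  refine hb ?_
  have (z : R ⧸ (I • ⊤ : Ideal R)) : a • z = b • z := by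
    obtain ⟨z, rfl⟩ := Submodule.Quotient.mk_surjective _ z
    rw [← Submodule.Quotient.mk_smul, ← Submodule.Quotient.mk_smul, Submodule.Quotient.eq,
      ← sub_smul]
    exact Submodule.smul_mem_smul h trivial
  simpa [this] using hxy

attribute [local instance] MvPolynomial.weightedGradedAlgebra

theorem zetaBar_isWeaklyRegular (k m : ℕ) :
    IsWeaklyRegular (MvPolynomial (Fin k) (ZMod 2))
      ((List.range k).map fun i => zetaBar k (m + 1 + i)) := by
  induction k generalizing m with
  | zero => exact .nil _ _
  | succ k ihk =>
    have hpos (n : ℕ) : 0 < 2 ^ (n + 1) - 1 := by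
      have := Nat.one_lt_two_pow (Nat.succ_ne_zero n)
      omega
    have hlast (m : ℕ) : IsWeaklyRegular (MvPolynomial (Fin (k + 1)) (ZMod 2))
        (((List.range k).map fun i => zetaBar (k + 1) (m + 1 + i)) ++ [X (Fin.last k)]) := by
      refine (isWeaklyRegular_X_last_cons
        (rs := (List.range k).map fun i => zetaBar (k + 1) (m + 1 + i)) ?_).perm_of_homogeneous
        (weightedHomogeneousSubmodule (ZMod 2) (xiDegree (k + 1)))
        (List.perm_append_singleton _ _).symm ?_
      · simpa [Function.comp_def, killLast_zetaBar] using ihk m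
      · intro r hr
        rw [List.mem_cons, List.mem_map] at hr
        rcases hr with rfl | ⟨i, -, rfl⟩
        · exact ⟨_, hpos k, isWeightedHomogeneous_X _ _ _⟩
        · exact ⟨_, hpos (m + i), by
            rw [show m + i + 1 = m + 1 + i by ring]
            exact zetaBar_isWeightedHomogeneous _ _⟩
    have hstep (m : ℕ) (h : IsSMulRegular (MvPolynomial (Fin (k + 1)) (ZMod 2) ⧸
        (Ideal.ofList ((List.range k).map fun i => zetaBar (k + 1) (m + 1 + i)) • ⊤ :
          Ideal (MvPolynomial (Fin (k + 1)) (ZMod 2)))) (zetaBar (k + 1) m)) :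
        IsWeaklyRegular (MvPolynomial (Fin (k + 1)) (ZMod 2))
          ((List.range (k + 1)).map fun i => zetaBar (k + 1) (m + 1 + i)) := by
      have hl := hlast m
      rw [isWeaklyRegular_append_iff, isWeaklyRegular_singleton_iff] at hl
      rw [List.range_succ, List.map_append, List.map_singleton, isWeaklyRegular_append_iff,
        isWeaklyRegular_singleton_iff]
      exact ⟨hl.1, .quotient_of_sub_mem (zetaBar_succ_add_sub_mem k m) ((hl.2.pow _).mul h)⟩
    induction m with
    | zero =>
      refine hstep 0 ?_
      rw [zetaBar_zero]
      exact .one _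
    | succ m ihm =>
      refine hstep (m + 1) ?_
      have h := ihm.perm_of_homogeneous
        (weightedHomogeneousSubmodule (ZMod 2) (xiDegree (k + 1)))
        (rs' := ((List.range k).map fun i => zetaBar (k + 1) (m + 1 + 1 + i)) ++
          [zetaBar (k + 1) (m + 1)]) ?_ ?_
      · rw [isWeaklyRegular_append_iff, isWeaklyRegular_singleton_iff] at h
        exact h.2
      · rw [List.range_succ_eq_map, List.map_cons, List.map_map]
        refine .trans (.of_eq ?_) (List.perm_append_singleton _ _).symm
        simp only [add_zero, List.cons.injEq, true_and]
        refine List.map_congr_left fun i _ => ?_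
        simp only [Function.comp_apply]
        congr 1
        omega
      · intro r hr
        obtain ⟨i, -, rfl⟩ := List.mem_map.1 hr
        exact ⟨_, hpos (m + i), by
          rw [show m + i + 1 = m + 1 + i by ring]
          exact zetaBar_isWeightedHomogeneous _ _⟩

/-- STATEMENT 6: For `k ≥ 1` and `m ≥ 0`, the elements `ζ̄_{m+1}, …, ζ̄_{m+k}`
form a regular sequence in `A⟨k⟩ = F₂[ξ₁, …, ξ_k]`, and `A⟨k⟩` is free as a
module over `F₂[y₁, …, y_k]` acting via `y_i ↦ ζ̄_{m+i}`. -/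
theorem zetaBar_isRegular_and_free (k m : ℕ) (hk : 1 ≤ k) :
    RingTheory.Sequence.IsRegular (MvPolynomial (Fin k) (ZMod 2))
      ((List.range k).map fun i => zetaBar k (m + 1 + i)) ∧
    @Module.Free (MvPolynomial (Fin k) (ZMod 2)) (MvPolynomial (Fin k) (ZMod 2)) _ _
      (Module.compHom _
        ((MvPolynomial.aeval fun i : Fin k => zetaBar k (m + 1 + (i : ℕ)) :
          MvPolynomial (Fin k) (ZMod 2) →ₐ[ZMod 2]
            MvPolynomial (Fin k) (ZMod 2)).toRingHom)) := by
  have hpos (i : ℕ) : 0 < 2 ^ (m + 1 + i) - 1 := by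
    have := Nat.one_lt_two_pow (show m + 1 + i ≠ 0 by omega)
    omega
  have hwr := zetaBar_isWeaklyRegular k m
  refine ⟨⟨hwr, fun htop => ?_⟩, ?_⟩
  · have hle : Ideal.ofList ((List.range k).map fun i => zetaBar k (m + 1 + i)) ≤
        RingHom.ker (constantCoeff (R := ZMod 2) (σ := Fin k)) := by
      refine Ideal.span_le.2 fun r hr => ?_
      obtain ⟨i, -, rfl⟩ := List.mem_map.1 hr
      exact (zetaBar_isWeightedHomogeneous k _).coeff_eq_zero 0
        (by rw [map_zero]; exact (hpos i).ne)
    rw [smul_eq_mul, Ideal.mul_top] at htop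
    exact RingHom.ker_ne_top _ (top_le_iff.1 (htop.trans_le hle))
  · refine IsWeaklyRegular.free_compHom_aeval
      (weightedHomogeneousSubmodule (ZMod 2) (xiDegree k)) (d := fun i => 2 ^ (m + 1 + i : ℕ) - 1)
      ?_ (fun i => hpos i) fun i => zetaBar_isWeightedHomogeneous k _
    convert! hwr
    refine List.ext_getElem (by simp) fun i _ _ => by simp
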